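/- Let f : ℍ² → ℂ be a Schwartz function on the quaternionic plane (identifying ℍ² with ℝ⁸) and let l be a nonzero quaternion. Then |l|⁴ · ∫_{ℍ²} conj(F_w f(x)) · F_w f(x·l) dx = |l|⁻⁴ · ∫_{ℍ²} conj(f(x)) · f(l⁻¹·x) dx, both integrals converging absolutely. (This is the isometry property ⟨F_w f, F_w f⟩ = ⟨f, f⟩_w of the twisted Fourier transform in the case F = ℍ.) -/

import Mathlib

open MeasureTheory Quaternion

/-- Borel measurable structure on the quaternions `ℍ ≅ ℝ⁴`. -/
noncomputable instance : MeasurableSpace ℍ := borel _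

instance : BorelSpace ℍ := ⟨rfl⟩

/-- The Fourier transform on `ℍ² = ℍ × ℍ ≅ ℝ⁸`:
`𝓕f(ξ) = ∫ f(x) e^{-2πi Re⟨x,ξ⟩} dx` where `⟨x,ξ⟩ = x̄₁ξ₁ + x̄₂ξ₂`. -/
noncomputable def fourierH2 (f : ℍ × ℍ → ℂ) (ξ : ℍ × ℍ) : ℂ :=
  ∫ x : ℍ × ℍ, f x *
    Complex.exp ((↑(-(2 * Real.pi * (star x.1 * ξ.1 + star x.2 * ξ.2).re)) : ℂ) * Complex.I)

/-- The twisted Fourier transform `F_w f(x) = 𝓕f((x̄₂, -x̄₁))`. -/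
noncomputable def FwH (f : ℍ × ℍ → ℂ) (x : ℍ × ℍ) : ℂ :=
  fourierH2 f (star x.2, -(star x.1))

open scoped SchwartzMap FourierTransform ComplexConjugate

instance isAddHaarMeasure_volume_quaternion_prod :
    (volume : Measure (ℍ × ℍ)).IsAddHaarMeasure :=
  inferInstanceAs ((volume : Measure ℍ).prod (volume : Measure ℍ)).IsAddHaarMeasure

/-- Left multiplication by a nonzero quaternion on `ℍ²`. -/
noncomputable def quaternionLeftMul (l : ℍ) (hl : l ≠ 0) : (ℍ × ℍ) ≃L[ℝ] (ℍ × ℍ) :=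
  LinearEquiv.toContinuousLinearEquiv
    { toFun := fun x => (l * x.1, l * x.2)
      invFun := fun x => (l⁻¹ * x.1, l⁻¹ * x.2)
      map_add' := fun x y => by simp [mul_add]
      map_smul' := fun c x => by simp
      left_inv := fun x => by simp [hl]
      right_inv := fun x => by simp [hl] }

/-- Quaternionic conjugation as a linear isometry of `ℍ`. -/
noncomputable def quaternionStar : ℍ ≃ₗᵢ[ℝ] ℍ where
  toFun := star
  invFun := star
  map_add' := star_add
  map_smul' c x := by simp
  left_inv := star_star
  right_inv := star_star
  norm_map' := Quaternion.norm_star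

/-- Left multiplication by a unit quaternion as a linear isometry of `ℍ`. -/
noncomputable def quaternionUnitMul (u : ℍ) (hu : ‖u‖ = 1) : ℍ ≃ₗᵢ[ℝ] ℍ where
  toFun x := u * x
  invFun x := u⁻¹ * x
  map_add' x y := mul_add _ _ _
  map_smul' c x := by simp
  left_inv x := by simp [norm_ne_zero_iff.mp (hu.trans_ne one_ne_zero)]
  right_inv x := by simp [norm_ne_zero_iff.mp (hu.trans_ne one_ne_zero)]
  norm_map' x := by simp [hu]

/-- The linear automorphism `(x₁, x₂) ↦ (x̄₂, -x̄₁)` of `ℍ²`. -/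
noncomputable def quaternionTwist : (ℍ × ℍ) ≃L[ℝ] (ℍ × ℍ) :=
  (ContinuousLinearEquiv.prodComm ℝ ℍ ℍ).trans
    (quaternionStar.toContinuousLinearEquiv.prodCongr
      (quaternionStar.trans (LinearIsometryEquiv.neg ℝ)).toContinuousLinearEquiv)

theorem quaternionTwist_apply (x : ℍ × ℍ) :
    quaternionTwist x = (star x.2, -star x.1) := rfl

theorem measurePreserving_quaternionTwist :
    MeasurePreserving quaternionTwist (volume : Measure (ℍ × ℍ)) volume :=
  ((quaternionStar.measurePreserving).prod
    (quaternionStar.trans (LinearIsometryEquiv.neg ℝ)).measurePreserving).comp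
    (Measure.measurePreserving_swap (μ := (volume : Measure ℍ)) (ν := (volume : Measure ℍ)))

theorem integral_quaternion_leftMul (G : ℍ × ℍ → ℂ) (l : ℍ) (hl : l ≠ 0) :
    ∫ x : ℍ × ℍ, G (l * x.1, l * x.2) = ((‖l‖ ^ 8)⁻¹ : ℝ) • ∫ x, G x := by
  have hn : ‖l‖ ≠ 0 := norm_ne_zero_iff.mpr hl
  have hu : ‖‖l‖⁻¹ • l‖ = 1 := by
    rw [norm_smul, norm_inv, norm_norm, inv_mul_cancel₀ hn]
  let e := quaternionUnitMul _ hu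
  have he : MeasurePreserving (Prod.map e e) (volume : Measure (ℍ × ℍ)) volume :=
    e.measurePreserving.prod e.measurePreserving
  have hemb : MeasurableEmbedding (Prod.map e e) :=
    (e.toHomeomorph.prodCongr e.toHomeomorph).measurableEmbedding
  have hfin : Module.finrank ℝ (ℍ × ℍ) = 8 := by
    rw [Module.finrank_prod, Quaternion.finrank_eq_four]
  have h := he.integral_comp hemb (fun x => G (‖l‖ • x))
  rw [Measure.integral_comp_smul_of_nonneg volume G ‖l‖ (hR := norm_nonneg l), hfin] at h
  rw [← h]
  refine integral_congr_ae (Filter.Eventually.of_forall fun x => ?_)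
  have hx : ∀ y : ℍ, l * y = ‖l‖ • e y := fun y => by
    change _ = ‖l‖ • ((‖l‖⁻¹ • l) * y)
    rw [smul_mul_assoc, smul_smul, mul_inv_cancel₀ hn, one_smul]
  simp only [hx]
  rfl

theorem fourierH2_comp_leftMul_inv (f : ℍ × ℍ → ℂ) (l : ℍ) (hl : l ≠ 0) (y : ℍ × ℍ) :
    fourierH2 f (star l * y.1, star l * y.2) =
      ((‖l‖ ^ 8)⁻¹ : ℝ) • fourierH2 (fun x => f (l⁻¹ * x.1, l⁻¹ * x.2)) y := by
  unfold fourierH2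
  rw [← integral_quaternion_leftMul _ l hl]
  simp [hl, mul_assoc]

/-- The quaternionic Fourier transform of a Schwartz function, as a Schwartz function. -/
noncomputable def fourierH2Schwartz (f : 𝓢(ℍ × ℍ, ℂ)) : 𝓢(ℍ × ℍ, ℂ) :=
  SchwartzMap.compCLMOfContinuousLinearEquiv ℂ
    (WithLp.prodContinuousLinearEquiv 2 ℝ ℍ ℍ).symm
    (𝓕 (SchwartzMap.compCLMOfContinuousLinearEquiv ℂ
      (WithLp.prodContinuousLinearEquiv 2 ℝ ℍ ℍ) f))

theorem measurableEmbedding_quaternion_toLp :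
    MeasurableEmbedding (@WithLp.toLp 2 (ℍ × ℍ)) :=
  (WithLp.prodContinuousLinearEquiv 2 ℝ ℍ ℍ).symm.toHomeomorph.measurableEmbedding

theorem integral_quaternion_toLp (G : WithLp 2 (ℍ × ℍ) → ℂ) :
    ∫ x : ℍ × ℍ, G (WithLp.toLp 2 x) = ∫ v, G v :=
  (WithLp.volume_preserving_toLp ℍ ℍ).integral_comp measurableEmbedding_quaternion_toLp G

theorem fourierH2Schwartz_apply (f : 𝓢(ℍ × ℍ, ℂ)) (ξ : ℍ × ℍ) :
    fourierH2Schwartz f ξ = fourierH2 f ξ := by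
  change 𝓕 (fun v : WithLp 2 (ℍ × ℍ) => f (WithLp.ofLp v)) (WithLp.toLp 2 ξ) = _
  rw [Real.fourier_eq', ← integral_quaternion_toLp]
  unfold fourierH2
  refine integral_congr_ae (Filter.Eventually.of_forall fun x => ?_)
  have h : ∀ a b : ℍ, (a * star b).re = (star a * b).re := fun a b => by
    simp only [Quaternion.re_mul, Quaternion.re_star, Quaternion.imI_star,
      Quaternion.imJ_star, Quaternion.imK_star]
    ring
  simp [WithLp.prod_inner_apply, Quaternion.inner_def, h, mul_comm]

/-- Plancherel's theorem on `ℍ²`. -/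
theorem integral_conj_fourierH2_mul (f g : 𝓢(ℍ × ℍ, ℂ)) :
    ∫ y, conj (fourierH2 f y) * fourierH2 g y = ∫ x, conj (f x) * g x := by
  have h := SchwartzMap.integral_inner_fourier_fourier
    (SchwartzMap.compCLMOfContinuousLinearEquiv ℂ (WithLp.prodContinuousLinearEquiv 2 ℝ ℍ ℍ) f)
    (SchwartzMap.compCLMOfContinuousLinearEquiv ℂ (WithLp.prodContinuousLinearEquiv 2 ℝ ℍ ℍ) g)
  rw [← integral_quaternion_toLp, ← integral_quaternion_toLp] at h
  simp only [RCLike.inner_apply'] at h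
  simp only [← fourierH2Schwartz_apply]
  exact h

theorem SchwartzMap.integrable_conj_mul (f g : 𝓢(ℍ × ℍ, ℂ)) :
    Integrable (fun x => conj (f x) * g x) :=
  (f.memLp 2).star.integrable_mul (g.memLp 2)

theorem FwH_rightMul (f : ℍ × ℍ → ℂ) (l : ℍ) (x : ℍ × ℍ) :
    FwH f (x.1 * l, x.2 * l) =
      fourierH2 f (star l * (quaternionTwist x).1, star l * (quaternionTwist x).2) := by
  simp [FwH, quaternionTwist_apply]

/-- Isometry of the twisted Fourier transform in the quaternionic case: for `f` Schwartz
on `ℍ²` and a nonzero quaternion `l`,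
`|l|⁴ ∫ conj(F_w f(x)) F_w f(x·l) dx = |l|⁻⁴ ∫ conj(f(x)) f(l⁻¹·x) dx`,
both integrals converging absolutely. -/
theorem stmt_2 (f : SchwartzMap (ℍ × ℍ) ℂ) (l : ℍ) (hl : l ≠ 0) :
    Integrable (fun x : ℍ × ℍ =>
      (starRingEnd ℂ) (FwH (⇑f) x) * FwH (⇑f) (x.1 * l, x.2 * l)) ∧
    Integrable (fun x : ℍ × ℍ =>
      (starRingEnd ℂ) (f x) * f (l⁻¹ * x.1, l⁻¹ * x.2)) ∧
    ((‖l‖ ^ 4 : ℝ) : ℂ) *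
        ∫ x : ℍ × ℍ, (starRingEnd ℂ) (FwH (⇑f) x) * FwH (⇑f) (x.1 * l, x.2 * l) =
      (((‖l‖ ^ 4)⁻¹ : ℝ) : ℂ) *
        ∫ x : ℍ × ℍ, (starRingEnd ℂ) (f x) * f (l⁻¹ * x.1, l⁻¹ * x.2) := by
  have hn : (‖l‖ : ℂ) ≠ 0 := by simpa using hl
  let g : 𝓢(ℍ × ℍ, ℂ) := SchwartzMap.compCLMOfContinuousLinearEquiv ℂ
    (quaternionLeftMul l⁻¹ (inv_ne_zero hl)) f
  have hT := measurePreserving_quaternionTwist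
  have hemb : MeasurableEmbedding quaternionTwist :=
    quaternionTwist.toHomeomorph.measurableEmbedding
  have key : (fun x : ℍ × ℍ => conj (FwH f x) * FwH f (x.1 * l, x.2 * l)) =
      (fun y => ((‖l‖ ^ 8)⁻¹ : ℝ) • (conj (fourierH2 f y) * fourierH2 g y)) ∘
        quaternionTwist := by
    funext x
    rw [FwH_rightMul, fourierH2_comp_leftMul_inv f l hl, mul_smul_comm]
    rfl
  refine ⟨?_, SchwartzMap.integrable_conj_mul f g, ?_⟩
  · rw [key, hT.integrable_comp_emb hemb]
    have h := SchwartzMap.integrable_conj_mul (fourierH2Schwartz f) (fourierH2Schwartz g)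
    simp only [fourierH2Schwartz_apply] at h
    exact h.smul ((‖l‖ ^ 8)⁻¹ : ℝ)
  · rw [key, Function.comp_def, hT.integral_comp hemb
      (fun y => ((‖l‖ ^ 8)⁻¹ : ℝ) • (conj (fourierH2 f y) * fourierH2 g y)),
      integral_smul, integral_conj_fourierH2_mul, Complex.real_smul, ← mul_assoc]
    congr 1
    push_cast
    field_simp
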